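/- arXiv:2205.02060 — 4 statements merged into one kernel-verified Lean document; each statement's English description precedes it below -/
import Mathlib

section
/- Let k ≥ 2, let ε, λ ∈ (0, 1/2), and let n ≤ (1/10)·(λε)^{-(k-1)}. Then there exist two k-tuples of probability densities on [0,1], D = (f_1, …, f_k) and D' = (f'_1, …, f'_k), whose CDFs F_i, F'_i satisfy |F_i(x) − F_i(y)| ≥ λ|x − y| and |F'_i(x) − F'_i(y)| ≥ λ|x − y| for all x, y ∈ [0,1], such that for every measurable estimator μ̂ mapping n observation pairs in ([0,1] × {1,…,k})^n to a k-tuple of probability measures on [0,1], at least one of the following two probabilities is at least 1/3: (a) the probability, over n i.i.d. samples (Y_i, Z_i) from the first-price observation model on D, that max_j W(μ̂((Y_i,Z_i)_{i=1}^n)_j, f_j) ≥ ε/8; (b) the same probability with D replaced by D' and samples (Y'_i, Z'_i) drawn from the model on D'. -/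
open MeasureTheory ProbabilityTheory Finset
open scoped ENNReal NNReal

/-- The (least) index attaining the maximum of a finite tuple of reals. -/
noncomputable def argmaxIdx {k : ℕ} [NeZero k] (x : Fin k → ℝ) : Fin k :=
  (Finset.univ.filter fun i => ∀ j, x j ≤ x i).min' (by
    obtain ⟨i, -, hi⟩ := Finset.exists_max_image (Finset.univ : Finset (Fin k)) x
      ⟨⟨0, Nat.pos_of_ne_zero (NeZero.ne k)⟩, Finset.mem_univ _⟩
    exact ⟨i, Finset.mem_filter.mpr ⟨Finset.mem_univ i, fun j => hi j (Finset.mem_univ j)⟩⟩)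

/-- The measure on `ℝ` with Lebesgue density `f`. -/
noncomputable def densityMeasure (f : ℝ → ℝ) : Measure ℝ :=
  MeasureTheory.volume.withDensity fun x => ENNReal.ofReal (f x)

/-- The law of a single observation `(Y, Z) = (max_i X_i, argmax_i X_i)` of a first-price
auction whose `k` independent bids have densities `f i`. -/
noncomputable def firstPriceObsLaw {k : ℕ} [NeZero k] (f : Fin k → ℝ → ℝ) :
    Measure (ℝ × Fin k) :=
  Measure.map (fun x => (⨆ i, x i, argmaxIdx x))
    (Measure.pi fun i => densityMeasure (f i))

/-- The law of `n` i.i.d. observations from the first-price auction model. -/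
noncomputable def firstPriceSamplesLaw {k : ℕ} [NeZero k] (n : ℕ) (f : Fin k → ℝ → ℝ) :
    Measure (Fin n → ℝ × Fin k) :=
  Measure.pi fun _ => firstPriceObsLaw f

/-- `f` is a probability density supported on `[0,1]`. -/
def IsDensityOn01 (f : ℝ → ℝ) : Prop :=
  Measurable f ∧ (∀ x, 0 ≤ f x) ∧ (∀ x, x ∉ Set.Icc (0:ℝ) 1 → f x = 0) ∧ (∫ x, f x) = 1

/-- The CDF of a density `f`. -/
noncomputable def cdfOf (f : ℝ → ℝ) (x : ℝ) : ℝ := ∫ t in Set.Iic x, f t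

/-- The 1-Wasserstein distance on `[0,1]`, expressed as the `L¹` distance of CDFs. -/
noncomputable def wassersteinDist (P Q : Measure ℝ) : ℝ :=
  ∫ t in Set.Ioc (0:ℝ) 1, |(P (Set.Iic t)).toReal - (Q (Set.Iic t)).toReal|

theorem argmaxIdx_eq_iff {k : ℕ} [NeZero k] (x : Fin k → ℝ) (i : Fin k) :
    argmaxIdx x = i ↔ (∀ j, x j ≤ x i) ∧ ∀ j, j < i → ∃ l, x j < x l := by
  unfold argmaxIdx
  rw [Finset.min'_eq_iff]
  simp only [Finset.mem_filter, Finset.mem_univ, true_and]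
  refine and_congr_right fun _ => forall_congr' fun j => ?_
  rw [← not_imp_not, not_le]
  simp only [not_forall, not_le]

theorem measurable_argmaxIdx {k : ℕ} [NeZero k] :
    Measurable (argmaxIdx : (Fin k → ℝ) → Fin k) := by
  refine measurable_to_countable' fun i => ?_
  have h : argmaxIdx ⁻¹' {i} =
      {x : Fin k → ℝ | (∀ j, x j ≤ x i) ∧ ∀ j, j < i → ∃ l, x j < x l} := by
    ext x
    exact argmaxIdx_eq_iff x i
  rw [h]
  measurability

theorem measurable_iSup_argmaxIdx {k : ℕ} [NeZero k] :
    Measurable (fun x : Fin k → ℝ => (⨆ i, x i, argmaxIdx x)) :=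
  (Measurable.iSup fun i => measurable_pi_apply i).prodMk measurable_argmaxIdx

/-- Clipping a tuple from below at a level under its maximum does not change the argmax. -/
theorem argmaxIdx_max_const {k : ℕ} [NeZero k] {c : ℝ} {x : Fin k → ℝ} (hx : ∃ i, c < x i) :
    argmaxIdx (fun i => max (x i) c) = argmaxIdx x := by
  obtain ⟨h₁, h₂⟩ := (argmaxIdx_eq_iff x (argmaxIdx x)).1 rfl
  obtain ⟨i, hi⟩ := hx
  rw [argmaxIdx_eq_iff]
  refine ⟨fun j => max_le_max_right c (h₁ j), fun j hj => ?_⟩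
  obtain ⟨l, hl⟩ := h₂ j hj
  exact ⟨argmaxIdx x, max_lt ((hl.trans_le (h₁ l)).trans_le (le_max_left _ _))
    ((hi.trans_le (h₁ i)).trans_le (le_max_left _ _))⟩

theorem iSup_max_const {k : ℕ} [NeZero k] (c : ℝ) (x : Fin k → ℝ) :
    ⨆ i, max (x i) c = max (⨆ i, x i) c := by
  apply le_antisymm
  · exact ciSup_le fun i => max_le_max_right c (le_ciSup (Set.finite_range x).bddAbove i)
  · have hb : BddAbove (Set.range fun i => max (x i) c) := (Set.finite_range _).bddAbove
    exact max_le (ciSup_mono hb fun i => le_max_left _ _)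
      ((le_max_right (x 0) c).trans (le_ciSup hb 0))

theorem lt_iSup_iff_exists {k : ℕ} [NeZero k] (c : ℝ) (x : Fin k → ℝ) :
    c < ⨆ i, x i ↔ ∃ i, c < x i :=
  lt_ciSup_iff (Set.finite_range x).bddAbove

theorem IsDensityOn01.integrable {f : ℝ → ℝ} (hf : IsDensityOn01 f) : Integrable f := by
  by_contra h
  exact zero_ne_one ((integral_undef h).symm.trans hf.2.2.2)

theorem IsDensityOn01.densityMeasure_Iic {f : ℝ → ℝ} (hf : IsDensityOn01 f) (t : ℝ) :
    densityMeasure f (Set.Iic t) = ENNReal.ofReal (cdfOf f t) := by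
  rw [densityMeasure, withDensity_apply _ measurableSet_Iic, cdfOf,
    ofReal_integral_eq_lintegral_ofReal hf.integrable.integrableOn
      (Filter.Eventually.of_forall hf.2.1)]

theorem IsDensityOn01.cdfOf_nonneg {f : ℝ → ℝ} (hf : IsDensityOn01 f) (t : ℝ) :
    0 ≤ cdfOf f t :=
  integral_nonneg hf.2.1

theorem IsDensityOn01.isProbabilityMeasure {f : ℝ → ℝ} (hf : IsDensityOn01 f) :
    IsProbabilityMeasure (densityMeasure f) := by
  refine ⟨?_⟩
  rw [densityMeasure, withDensity_apply _ MeasurableSet.univ, Measure.restrict_univ,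
    ← ofReal_integral_eq_lintegral_ofReal hf.integrable (Filter.Eventually.of_forall hf.2.1),
    hf.2.2.2, ENNReal.ofReal_one]

theorem map_max_const_eq {μ ν : Measure ℝ} [IsFiniteMeasure μ] [IsFiniteMeasure ν] {c : ℝ}
    (h : ∀ t, c ≤ t → μ (Set.Iic t) = ν (Set.Iic t)) :
    μ.map (fun x => max x c) = ν.map (fun x => max x c) := by
  have hm : Measurable fun x : ℝ => max x c := measurable_id.max measurable_const
  refine Measure.ext_of_Iic _ _ fun t => ?_
  rw [Measure.map_apply hm measurableSet_Iic, Measure.map_apply hm measurableSet_Iic]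
  by_cases hc : c ≤ t
  · have hs : (fun x : ℝ => max x c) ⁻¹' Set.Iic t = Set.Iic t := by
      ext x
      simp [hc]
    rw [hs, h t hc]
  · have hs : (fun x : ℝ => max x c) ⁻¹' Set.Iic t = ∅ := by
      ext x
      simp [hc]
    rw [hs, measure_empty, measure_empty]

/-- Above the level `c`, the observation law depends only on the clipped bid laws. -/
theorem firstPriceObsLaw_restrict {k : ℕ} [NeZero k] {f : Fin k → ℝ → ℝ}
    (hf : ∀ i, IsDensityOn01 (f i)) (c : ℝ) :
    (firstPriceObsLaw f).restrict (Set.Ioi c ×ˢ Set.univ) =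
      ((Measure.pi fun i => (densityMeasure (f i)).map fun x => max x c).map
        fun x => (⨆ i, x i, argmaxIdx x)).restrict (Set.Ioi c ×ˢ Set.univ) := by
  have hm : Measurable fun x : ℝ => max x c := measurable_id.max measurable_const
  have := fun i => (hf i).isProbabilityMeasure
  have := fun i => Measure.isProbabilityMeasure_map (μ := densityMeasure (f i)) hm.aemeasurable
  have hG : MeasurableSet (Set.Ioi c ×ˢ (Set.univ : Set (Fin k))) :=
    measurableSet_Ioi.prod MeasurableSet.univ
  have hmp : Measurable fun (x : Fin k → ℝ) i => max (x i) c :=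
    measurable_pi_lambda _ fun i => hm.comp (measurable_pi_apply i)
  rw [← Measure.pi_map_pi fun i => hm.aemeasurable, Measure.map_map measurable_iSup_argmaxIdx hmp]
  ext s hs
  rw [Measure.restrict_apply hs, Measure.restrict_apply hs, firstPriceObsLaw,
    Measure.map_apply measurable_iSup_argmaxIdx (hs.inter hG),
    Measure.map_apply (measurable_iSup_argmaxIdx.comp hmp) (hs.inter hG)]
  congr 1
  ext x
  by_cases hx : c < ⨆ i, x i
  · simp [iSup_max_const, argmaxIdx_max_const ((lt_iSup_iff_exists c x).1 hx), hx,
      max_eq_left hx.le]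
  · simp [iSup_max_const, hx]

theorem firstPriceObsLaw_restrict_eq {k : ℕ} [NeZero k] {f f' : Fin k → ℝ → ℝ}
    (hf : ∀ i, IsDensityOn01 (f i)) (hf' : ∀ i, IsDensityOn01 (f' i)) {c : ℝ}
    (h : ∀ i t, c ≤ t → cdfOf (f i) t = cdfOf (f' i) t) :
    (firstPriceObsLaw f).restrict (Set.Ioi c ×ˢ Set.univ) =
      (firstPriceObsLaw f').restrict (Set.Ioi c ×ˢ Set.univ) := by
  have := fun i => (hf i).isProbabilityMeasure
  have := fun i => (hf' i).isProbabilityMeasure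
  have hmap : ∀ i, (densityMeasure (f i)).map (fun x => max x c) =
      (densityMeasure (f' i)).map (fun x => max x c) := fun i =>
    map_max_const_eq fun t ht => by
      rw [(hf i).densityMeasure_Iic, (hf' i).densityMeasure_Iic, h i t ht]
  rw [firstPriceObsLaw_restrict hf, firstPriceObsLaw_restrict hf']
  simp only [hmap]

theorem isProbabilityMeasure_firstPriceObsLaw {k : ℕ} [NeZero k] {f : Fin k → ℝ → ℝ}
    (hf : ∀ i, IsDensityOn01 (f i)) : IsProbabilityMeasure (firstPriceObsLaw f) := by
  have := fun i => (hf i).isProbabilityMeasure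
  exact Measure.isProbabilityMeasure_map measurable_iSup_argmaxIdx.aemeasurable

theorem firstPriceObsLaw_Ioi {k : ℕ} [NeZero k] {f : Fin k → ℝ → ℝ}
    (hf : ∀ i, IsDensityOn01 (f i)) (c : ℝ) :
    (firstPriceObsLaw f).real (Set.Ioi c ×ˢ Set.univ) = 1 - ∏ i, cdfOf (f i) c := by
  have := fun i => (hf i).isProbabilityMeasure
  have := isProbabilityMeasure_firstPriceObsLaw hf
  have hG : MeasurableSet (Set.Ioi c ×ˢ (Set.univ : Set (Fin k))) :=
    measurableSet_Ioi.prod MeasurableSet.univ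
  have hpre : (fun x : Fin k → ℝ => (⨆ i, x i, argmaxIdx x)) ⁻¹'
      (Set.Ioi c ×ˢ (Set.univ : Set (Fin k)))ᶜ = Set.univ.pi fun _ => Set.Iic c := by
    ext x
    simp [lt_iSup_iff_exists, Pi.le_def]
  have hcompl : (firstPriceObsLaw f).real (Set.Ioi c ×ˢ Set.univ)ᶜ = ∏ i, cdfOf (f i) c := by
    rw [measureReal_def, firstPriceObsLaw, Measure.map_apply measurable_iSup_argmaxIdx hG.compl,
      hpre, Measure.pi_pi, ENNReal.toReal_prod]
    refine Finset.prod_congr rfl fun i _ => ?_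
    rw [(hf i).densityMeasure_Iic, ENNReal.toReal_ofReal ((hf i).cdfOf_nonneg c)]
  rw [← hcompl, probReal_compl_eq_one_sub hG]
  ring

/-- Le Cam's two-point argument for sample laws agreeing on a set of large probability. -/
theorem pow_le_add_of_restrict_eq {α : Type*} [MeasurableSpace α] {P Q : Measure α}
    [IsProbabilityMeasure P] [IsProbabilityMeasure Q] {G : Set α}
    (hPQ : P.restrict G = Q.restrict G) {n : ℕ} {A B : Set (Fin n → α)}
    (hAB : A ∪ B = Set.univ) :
    P G ^ n ≤ Measure.pi (fun _ => P) A + Measure.pi (fun _ => Q) B := by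
  set R : Measure (Fin n → α) := Measure.pi fun _ => P.restrict G with hR
  have hRP : R ≤ Measure.pi fun _ => P := by
    rw [hR, ← Measure.restrict_pi_pi]
    exact Measure.restrict_le_self
  have hRQ : R ≤ Measure.pi fun _ => Q := by
    rw [hR, hPQ, ← Measure.restrict_pi_pi]
    exact Measure.restrict_le_self
  calc P G ^ n = R Set.univ := by simp [hR, Measure.pi_univ]
    _ ≤ R A + R B := hAB ▸ measure_union_le A B
    _ ≤ _ := add_le_add (hRP A) (hRQ B)

/-- The density of the mixture `lam • U[0,1] + (1 - lam) • U[a,b]` of uniform laws. -/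
noncomputable def uniformMix (lam a b : ℝ) (x : ℝ) : ℝ :=
  (Set.Icc (0:ℝ) 1).indicator (fun _ => lam) x +
    (Set.Ioc a b).indicator (fun _ => (1 - lam) / (b - a)) x

theorem integrable_indicator_Icc_const (c : ℝ) :
    Integrable ((Set.Icc (0:ℝ) 1).indicator fun _ => c) :=
  (integrable_indicator_iff measurableSet_Icc).2 (integrableOn_const (by simp))

theorem integrable_indicator_Ioc_const (a b c : ℝ) :
    Integrable ((Set.Ioc a b).indicator fun _ => c) :=
  (integrable_indicator_iff measurableSet_Ioc).2 (integrableOn_const (by simp))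

theorem cdfOf_uniformMix (lam a b t : ℝ) :
    cdfOf (uniformMix lam a b) t =
      lam * max (min 1 t) 0 + (1 - lam) / (b - a) * max (min b t - a) 0 := by
  unfold cdfOf uniformMix
  rw [integral_add (integrable_indicator_Icc_const _).integrableOn
    (integrable_indicator_Ioc_const _ _ _).integrableOn,
    integral_indicator_const _ measurableSet_Icc, integral_indicator_const _ measurableSet_Ioc,
    measureReal_restrict_apply measurableSet_Icc, measureReal_restrict_apply measurableSet_Ioc,
    Set.Ioc_inter_Iic, ← Set.Ici_inter_Iic, Set.inter_assoc, Set.Iic_inter_Iic,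
    Set.Ici_inter_Iic, Real.volume_real_Icc, Real.volume_real_Ioc]
  simp [mul_comm]

theorem cdfOf_uniformMix_of_le {lam a b t : ℝ} (hab : a < b) (ht : t ≤ a) :
    cdfOf (uniformMix lam a b) t = lam * max (min 1 t) 0 := by
  rw [cdfOf_uniformMix, min_eq_right (ht.trans hab.le), max_eq_right (sub_nonpos.2 ht)]
  ring

theorem cdfOf_uniformMix_of_ge {lam a b t : ℝ} (hab : a < b) (ht : b ≤ t) :
    cdfOf (uniformMix lam a b) t = lam * max (min 1 t) 0 + (1 - lam) := by
  rw [cdfOf_uniformMix, min_eq_left ht, max_eq_left (sub_pos.2 hab).le,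
    div_mul_cancel₀ _ (sub_pos.2 hab).ne']

theorem isDensityOn01_uniformMix {lam a b : ℝ} (h0 : 0 ≤ lam) (h1 : lam ≤ 1)
    (ha : 0 ≤ a) (hab : a < b) (hb : b ≤ 1) : IsDensityOn01 (uniformMix lam a b) := by
  refine ⟨(measurable_const.indicator measurableSet_Icc).add
    (measurable_const.indicator measurableSet_Ioc), fun x => ?_, fun x hx => ?_, ?_⟩
  · exact add_nonneg (Set.indicator_nonneg (fun _ _ => h0) x) (Set.indicator_nonneg
      (fun _ _ => div_nonneg (sub_nonneg.2 h1) (sub_pos.2 hab).le) x)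
  · have hx' : x ∉ Set.Ioc a b := fun h => hx ⟨ha.trans h.1.le, h.2.trans hb⟩
    simp [uniformMix, hx, hx']
  · unfold uniformMix
    rw [integral_add (integrable_indicator_Icc_const _) (integrable_indicator_Ioc_const _ _ _),
      integral_indicator_const _ measurableSet_Icc, integral_indicator_const _ measurableSet_Ioc,
      Real.volume_real_Icc, Real.volume_real_Ioc, max_eq_left (sub_pos.2 hab).le, smul_eq_mul,
      smul_eq_mul, mul_div_cancel₀ _ (sub_pos.2 hab).ne']
    norm_num

theorem cdfOf_uniformMix_antilipschitz {lam a b : ℝ} (h1 : lam ≤ 1)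
    (hab : a < b) :
    ∀ x ∈ Set.Icc (0:ℝ) 1, ∀ y ∈ Set.Icc (0:ℝ) 1,
      lam * |x - y| ≤ |cdfOf (uniformMix lam a b) x - cdfOf (uniformMix lam a b) y| := by
  have key : ∀ x ∈ Set.Icc (0:ℝ) 1, ∀ y ∈ Set.Icc (0:ℝ) 1, y ≤ x →
      lam * |x - y| ≤ |cdfOf (uniformMix lam a b) x - cdfOf (uniformMix lam a b) y| := by
    intro x hx y hy hxy
    refine le_trans ?_ (le_abs_self _)
    have hc : 0 ≤ (1 - lam) / (b - a) := div_nonneg (sub_nonneg.2 h1) (sub_pos.2 hab).le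
    have hm : max (min b y - a) 0 ≤ max (min b x - a) 0 := by gcongr
    rw [abs_of_nonneg (sub_nonneg.2 hxy), cdfOf_uniformMix, cdfOf_uniformMix,
      min_eq_right hx.2, min_eq_right hy.2, max_eq_left hx.1, max_eq_left hy.1]
    nlinarith [mul_le_mul_of_nonneg_left hm hc]
  intro x hx y hy
  rcases le_total y x with h | h
  · exact key x hx y hy h
  · rw [abs_sub_comm x, abs_sub_comm (cdfOf _ x)]
    exact key y hy x hx h

theorem integrable_abs_cdf_sub (P Q : Measure ℝ) [IsProbabilityMeasure P]
    [IsProbabilityMeasure Q] (s t : ℝ) :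
    IntegrableOn (fun x => |(P (Set.Iic x)).toReal - (Q (Set.Iic x)).toReal|) (Set.Ioc s t) := by
  have hmono : ∀ (R : Measure ℝ) [IsProbabilityMeasure R],
      IntegrableOn (fun x => (R (Set.Iic x)).toReal) (Set.Ioc s t) := fun R _ =>
    ((show Monotone fun x => R.real (Set.Iic x) from fun _ _ h =>
      measureReal_mono (Set.Iic_subset_Iic.2 h)).monotoneOn _).integrableOn_isCompact
        isCompact_Icc |>.mono_set Set.Ioc_subset_Icc_self
  exact ((hmono P).sub (hmono Q)).abs

/-- If two CDFs differ by at least `δ` on `(s, t]`, then any third law is far from one of them. -/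
theorem mul_le_wassersteinDist_add {P Q R : Measure ℝ} [IsProbabilityMeasure P]
    [IsProbabilityMeasure Q] [IsProbabilityMeasure R] {s t δ : ℝ} (hs : 0 ≤ s) (hst : s ≤ t)
    (ht : t ≤ 1)
    (h : ∀ x ∈ Set.Ioc s t, δ ≤ |(P (Set.Iic x)).toReal - (Q (Set.Iic x)).toReal|) :
    (t - s) * δ ≤ wassersteinDist R P + wassersteinDist R Q := by
  have hsub : Set.Ioc s t ⊆ Set.Ioc 0 1 := Set.Ioc_subset_Ioc hs ht
  have hint := (integrable_abs_cdf_sub R P 0 1).add (integrable_abs_cdf_sub R Q 0 1)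
  unfold wassersteinDist
  rw [← integral_add (integrable_abs_cdf_sub R P 0 1) (integrable_abs_cdf_sub R Q 0 1)]
  calc (t - s) * δ = ∫ _ in Set.Ioc s t, δ := by
        rw [setIntegral_const, Real.volume_real_Ioc_of_le hst, smul_eq_mul]
    _ ≤ ∫ x in Set.Ioc s t, (|(R (Set.Iic x)).toReal - (P (Set.Iic x)).toReal| +
          |(R (Set.Iic x)).toReal - (Q (Set.Iic x)).toReal|) := by
        refine setIntegral_mono_on (integrableOn_const (by simp)) (hint.mono_set hsub)
          measurableSet_Ioc fun x hx => (h x hx).trans ?_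
        rw [abs_sub_comm (R _).toReal (P _).toReal]
        exact abs_sub_le _ _ _
    _ ≤ _ := setIntegral_mono_set hint
        (Filter.Eventually.of_forall fun x => add_nonneg (abs_nonneg _) (abs_nonneg _))
        (Filter.Eventually.of_forall hsub)

theorem third_le_max_of_two_thirds_le_add {a b : ℝ≥0∞} (h : ENNReal.ofReal (2 / 3) ≤ a + b) :
    (1 / 3 : ℝ≥0∞) ≤ max a b := by
  have e : (1 / 3 : ℝ≥0∞) = ENNReal.ofReal (1 / 3) := by
    rw [ENNReal.ofReal_div_of_pos (by norm_num)]
    simp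
  by_contra! hlt
  rw [e] at hlt
  have := ENNReal.add_lt_add ((le_max_left a b).trans_lt hlt) ((le_max_right a b).trans_lt hlt)
  rw [← ENNReal.ofReal_add (by norm_num) (by norm_num)] at this
  norm_num at this
  norm_num at h
  exact absurd h (not_le.2 this)

/-- For `k ≥ 2`, `ε, λ ∈ (0,1/2)` and `n ≤ (1/10)(λε)^{-(k-1)}`, there are two
`k`-tuples of densities on `[0,1]`, both with `λ`-anti-Lipschitz CDFs, such that every
(measurable) estimator mapping `n` observations to `k` probability measures on `[0,1]` fails —
with probability at least `1/3` over the i.i.d. samples from one of the two first-price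
observation models — to estimate some bid distribution within `ε/8` in Wasserstein distance. -/
theorem first_price_full_support_lower_bound
    (k : ℕ) (hk : 2 ≤ k) (ε lam : ℝ)
    (hε : ε ∈ Set.Ioo (0:ℝ) (1/2)) (hlam : lam ∈ Set.Ioo (0:ℝ) (1/2))
    (n : ℕ) (hn : (n : ℝ) ≤ (lam * ε)⁻¹ ^ (k - 1) / 10) :
    haveI : NeZero k := ⟨by omega⟩
    ∃ f f' : Fin k → ℝ → ℝ,
      (∀ i, IsDensityOn01 (f i)) ∧ (∀ i, IsDensityOn01 (f' i)) ∧
      (∀ i, ∀ x ∈ Set.Icc (0:ℝ) 1, ∀ y ∈ Set.Icc (0:ℝ) 1,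
        lam * |x - y| ≤ |cdfOf (f i) x - cdfOf (f i) y|) ∧
      (∀ i, ∀ x ∈ Set.Icc (0:ℝ) 1, ∀ y ∈ Set.Icc (0:ℝ) 1,
        lam * |x - y| ≤ |cdfOf (f' i) x - cdfOf (f' i) y|) ∧
      (∀ μhat : (Fin n → ℝ × Fin k) → Fin k → Measure ℝ,
        Measurable μhat →
        (∀ w j, IsProbabilityMeasure (μhat w j)) →
        (∀ w j, μhat w j (Set.Icc (0:ℝ) 1)ᶜ = 0) →
        (1/3 : ℝ≥0∞) ≤
          max
            (firstPriceSamplesLaw n f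
              {w | ∃ j, ε/8 ≤ wassersteinDist (μhat w j) (densityMeasure (f j))})
            (firstPriceSamplesLaw n f'
              {w | ∃ j, ε/8 ≤ wassersteinDist (μhat w j) (densityMeasure (f' j))})) := by
  have : NeZero k := ⟨by omega⟩
  obtain ⟨hε0, hε1⟩ := hε
  obtain ⟨hl0, hl1⟩ := hlam
  have hl1' : lam ≤ 1 := by linarith
  set f : Fin k → ℝ → ℝ := fun i =>
    if i = 0 then uniformMix lam 0 (ε / 4) else uniformMix lam ε 1 with hf_def
  set f' : Fin k → ℝ → ℝ := fun i =>
    if i = 0 then uniformMix lam (3 * ε / 4) ε else uniformMix lam ε 1 with hf'_def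
  have hf : ∀ i, IsDensityOn01 (f i) := fun i => by
    simp only [hf_def]
    split_ifs <;> apply isDensityOn01_uniformMix <;> linarith
  have hf' : ∀ i, IsDensityOn01 (f' i) := fun i => by
    simp only [hf'_def]
    split_ifs <;> apply isDensityOn01_uniformMix <;> linarith
  refine ⟨f, f', hf, hf', fun i => ?_, fun i => ?_, fun μhat _ hμ _ => ?_⟩
  · simp only [hf_def]
    split_ifs <;> apply cdfOf_uniformMix_antilipschitz <;> linarith
  · simp only [hf'_def]
    split_ifs <;> apply cdfOf_uniformMix_antilipschitz <;> linarith
  have := isProbabilityMeasure_firstPriceObsLaw hf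
  have := isProbabilityMeasure_firstPriceObsLaw hf'
  have hcdf : ∀ i t, ε ≤ t → cdfOf (f i) t = cdfOf (f' i) t := by
    intro i t ht
    simp only [hf_def, hf'_def]
    split_ifs
    · rw [cdfOf_uniformMix_of_ge (by linarith) (by linarith),
        cdfOf_uniformMix_of_ge (by linarith) (by linarith)]
    · rfl
  have hprod : ∏ i, cdfOf (f i) ε ≤ (lam * ε) ^ (k - 1) := by
    rw [← Finset.mul_prod_erase _ _ (Finset.mem_univ (0 : Fin k))]
    have h0 : cdfOf (f 0) ε ≤ 1 := by
      simp only [hf_def, if_true]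
      rw [cdfOf_uniformMix_of_ge (by linarith) (by linarith), min_eq_right (by linarith),
        max_eq_left hε0.le]
      nlinarith
    have hrest : ∏ i ∈ Finset.univ.erase (0 : Fin k), cdfOf (f i) ε = (lam * ε) ^ (k - 1) := by
      rw [Finset.prod_congr rfl (g := fun _ => lam * ε), Finset.prod_const,
        Finset.card_erase_of_mem (Finset.mem_univ _), Finset.card_univ, Fintype.card_fin]
      intro i hi
      simp only [hf_def, if_neg (Finset.ne_of_mem_erase hi)]
      rw [cdfOf_uniformMix_of_le (by linarith) le_rfl, min_eq_right (by linarith),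
        max_eq_left hε0.le]
    rw [hrest]
    exact mul_le_of_le_one_left (by positivity) h0
  have hpow : ENNReal.ofReal (2 / 3) ≤ (firstPriceObsLaw f) (Set.Ioi ε ×ˢ Set.univ) ^ n := by
    set p := (lam * ε) ^ (k - 1) with hp
    have hp0 : 0 < p := by positivity
    have hp1 : p ≤ 1 := pow_le_one₀ (by positivity) (by nlinarith)
    have hnp : n * p ≤ 1 / 10 := by
      rw [inv_pow, ← hp] at hn
      calc n * p ≤ p⁻¹ / 10 * p := by gcongr
        _ = 1 / 10 := by field_simp
    have hbern := one_add_mul_le_pow (show (-2 : ℝ) ≤ -p by linarith) n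
    have hle : 1 + -p ≤ (firstPriceObsLaw f).real (Set.Ioi ε ×ˢ Set.univ) := by
      rw [firstPriceObsLaw_Ioi hf]
      linarith
    rw [← ofReal_measureReal, ← ENNReal.ofReal_pow measureReal_nonneg]
    apply ENNReal.ofReal_le_ofReal
    have := pow_le_pow_left₀ (by linarith) hle n
    linarith
  refine third_le_max_of_two_thirds_le_add (hpow.trans
    (pow_le_add_of_restrict_eq (firstPriceObsLaw_restrict_eq hf hf' hcdf) ?_))
  refine Set.eq_univ_of_forall fun w => ?_
  by_contra hw
  simp only [Set.mem_union, Set.mem_ofPred_eq, not_or, not_exists, not_le] at hw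
  have := (hf 0).isProbabilityMeasure
  have := (hf' 0).isProbabilityMeasure
  have := hμ w 0
  have hW := mul_le_wassersteinDist_add (P := densityMeasure (f 0)) (Q := densityMeasure (f' 0))
    (R := μhat w 0) (s := ε / 4) (t := 3 * ε / 4) (δ := 1 - lam)
    (by linarith) (by linarith) (by linarith) (fun x hx => by
      rw [(hf 0).densityMeasure_Iic, (hf' 0).densityMeasure_Iic,
        ENNReal.toReal_ofReal ((hf 0).cdfOf_nonneg x),
        ENNReal.toReal_ofReal ((hf' 0).cdfOf_nonneg x)]
      refine le_trans ?_ (le_abs_self _)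
      simp only [hf_def, hf'_def, if_true]
      rw [cdfOf_uniformMix_of_ge (by linarith) hx.1.le,
        cdfOf_uniformMix_of_le (by linarith) hx.2]
      linarith)
  nlinarith [hw.1 0, hw.2 0]
end

section
/- Let k ≥ 2, let F_1, …, F_k : ℝ → [0,1] be differentiable at a point b with derivatives f_j(b) and F_j(b) > 0 for all j, and suppose α_i is a function differentiable at b satisfying the equilibrium relation ∑_{j ≠ i} f_j(b)/F_j(b) = 1/(α_i(b) − b) (with α_i(b) ≠ b). Fix v ∈ ℝ and b* with v = α_i(b*), and define the utility u_i(b; v) = (v − b) · ∏_{j ≠ i} F_j(b). Then (d/db) u_i(b; v) = (α_i(b*) − α_i(b)) · ( ∑_{j ≠ i} f_j(b)/F_j(b) ) · ∏_{j ≠ i} F_j(b). -/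
open Finset

/-- Logarithmic form of the product rule: at a point where no factor vanishes, the derivative of a
finite product is the product times the sum of the logarithmic derivatives of the factors. -/
theorem HasDerivAt.finset_prod_of_ne_zero {ι 𝕜 : Type*} [DecidableEq ι]
    [NontriviallyNormedField 𝕜] {s : Finset ι} {f : ι → 𝕜 → 𝕜} {f' : ι → 𝕜} {x : 𝕜}
    (hf : ∀ j ∈ s, HasDerivAt (f j) (f' j) x) (hne : ∀ j ∈ s, f j x ≠ 0) :
    HasDerivAt (fun t => ∏ j ∈ s, f j t) ((∑ j ∈ s, f' j / f j x) * ∏ j ∈ s, f j x) x := by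
  refine (HasDerivAt.fun_finsetProd hf).congr_deriv (Eq.symm ?_)
  rw [Finset.sum_mul]
  refine Finset.sum_congr rfl fun j hj => ?_
  have hj0 := hne j hj
  rw [← Finset.mul_prod_erase s (fun j => f j x) hj, smul_eq_mul]
  field_simp

/-- (Derivative of the first-price utility function.) If the bid CDFs `F j`
are differentiable at `b` with derivatives `fval j`, positive at `b`, and the inverse bid
function `αi` (differentiable at `b`) satisfies the equilibrium relation
`∑_{j ≠ i} fval j / F j b = 1/(αi b − b)`, then for `v = αi b*`, the utility
`u_i(t; v) = (v − t) ∏_{j ≠ i} F j t` has derivative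
`(αi b* − αi b) · (∑_{j ≠ i} fval j / F j b) · ∏_{j ≠ i} F j b` at `b`. -/
theorem utility_derivative
    (k : ℕ) (hk : 2 ≤ k) (i : Fin k)
    (F : Fin k → ℝ → ℝ) (fval : Fin k → ℝ) (b : ℝ)
    (hF : ∀ j, HasDerivAt (F j) (fval j) b)
    (hFpos : ∀ j, 0 < F j b)
    (αi : ℝ → ℝ) (hαdiff : DifferentiableAt ℝ αi b)
    (hne : αi b ≠ b)
    (heq : ∑ j ∈ Finset.univ.erase i, fval j / F j b = 1 / (αi b - b))
    (v bstar : ℝ) (hv : v = αi bstar) :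
    HasDerivAt (fun t => (v - t) * ∏ j ∈ Finset.univ.erase i, F j t)
      ((αi bstar - αi b) * (∑ j ∈ Finset.univ.erase i, fval j / F j b) *
        ∏ j ∈ Finset.univ.erase i, F j b) b := by
  have hprod := HasDerivAt.finset_prod_of_ne_zero (s := Finset.univ.erase i)
    (fun j _ => hF j) (fun j _ => (hFpos j).ne')
  refine (((hasDerivAt_id b).const_sub v).mul hprod).congr_deriv (Eq.symm ?_)
  have hsum : (αi b - b) * ∑ j ∈ Finset.univ.erase i, fval j / F j b = 1 := by
    rw [heq, mul_one_div_cancel (sub_ne_zero.mpr hne)]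
  rw [hv, id]
  linear_combination (-∏ j ∈ Finset.univ.erase i, F j b) * hsum
end

section
/- Let k ≥ 2 and let f_1, …, f_k be probability densities on [0,1] with α ≤ f_i(x) ≤ η for all x and all i, where 0 < α ≤ η, and let F_i be the corresponding CDFs. Define g_i(x) = (1 − F_i(x)) · ∑_{j ≠ i} f_j(x) ∏_{l ≠ i, j} F_l(x). Then for every i and every x ∈ [0,1]: g_i(x) ≤ η²/α. -/
open MeasureTheory Finset

/-- If `f` vanishes outside `[0,1]`, its mass above `x` is its mass on `(x, 1]`. -/
theorem setIntegral_Ioi_eq_Ioc_of_supp {f : ℝ → ℝ} {x : ℝ}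
    (hsupp : ∀ z, z ∉ Set.Icc (0 : ℝ) 1 → f z = 0) :
    ∫ z in Set.Ioi x, f z = ∫ z in Set.Ioc x 1, f z := by
  refine setIntegral_eq_of_subset_of_forall_sdiff_eq_zero measurableSet_Ioi
    Set.Ioc_subset_Ioi_self fun z hz => hsupp z fun hz' => hz.2 ⟨hz.1, hz'.2⟩

/-- A density on `[0,1]` with values in `[α, η]` has tail mass between `α (1 - x)` and
`η (1 - x)`. -/
theorem one_sub_cdf_mem_Icc {f : ℝ → ℝ} {α η x : ℝ} (hint : Integrable f)
    (hbounds : ∀ z ∈ Set.Icc (0 : ℝ) 1, α ≤ f z ∧ f z ≤ η)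
    (hsupp : ∀ z, z ∉ Set.Icc (0 : ℝ) 1 → f z = 0)
    (hprob : ∫ z, f z = 1) (hx : x ∈ Set.Icc (0 : ℝ) 1) :
    1 - ∫ z in Set.Iic x, f z ∈ Set.Icc (α * (1 - x)) (η * (1 - x)) := by
  have htail : 1 - ∫ z in Set.Iic x, f z = ∫ z in Set.Ioc x 1, f z := by
    rw [← setIntegral_Ioi_eq_Ioc_of_supp hsupp, ← hprob,
      ← intervalIntegral.integral_Iic_add_Ioi hint.integrableOn hint.integrableOn (b := x)]
    ring
  have hconst (c : ℝ) : ∫ _ in Set.Ioc x 1, c = c * (1 - x) := by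
    rw [setIntegral_const, Real.volume_real_Ioc_of_le hx.2, smul_eq_mul, mul_comm]
  have hmem : ∀ z ∈ Set.Ioc x 1, z ∈ Set.Icc (0 : ℝ) 1 :=
    fun z hz => ⟨hx.1.trans hz.1.le, hz.2⟩
  rw [htail, ← hconst, ← hconst]
  exact ⟨setIntegral_mono_on (integrableOn_const measure_Ioc_lt_top.ne) hint.integrableOn
      measurableSet_Ioc fun z hz => (hbounds z (hmem z hz)).1,
    setIntegral_mono_on hint.integrableOn (integrableOn_const measure_Ioc_lt_top.ne)
      measurableSet_Ioc fun z hz => (hbounds z (hmem z hz)).2⟩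

theorem nat_mul_one_sub_mul_pow_le_one {t : ℝ} (h0 : 0 ≤ t) (h1 : t ≤ 1) (n : ℕ) :
    n * (1 - t) * t ^ (n - 1) ≤ 1 := by
  have hsum : n * t ^ (n - 1) ≤ ∑ i ∈ range n, t ^ i := by
    rw [← nsmul_eq_mul]
    simpa using card_nsmul_le_sum (range n) (fun i => t ^ i) (t ^ (n - 1)) fun i hi =>
      pow_le_pow_of_le_one h0 h1 (by have := mem_range.1 hi; omega)
  calc n * (1 - t) * t ^ (n - 1) = (1 - t) * (n * t ^ (n - 1)) := by ring
    _ ≤ (1 - t) * ∑ i ∈ range n, t ^ i :=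
      mul_le_mul_of_nonneg_left hsum (sub_nonneg.2 h1)
    _ = 1 - t ^ n := mul_neg_geom_sum t n
    _ ≤ 1 := sub_le_self _ (pow_nonneg h0 n)

/-- If all `p l` lie in `[0, t]` and all `c j` in `[0, η]`, the sum of the leave-one-out products
of `p` weighted by `c` is at most `#s * η * t ^ (#s - 1)`. -/
theorem sum_mul_prod_erase_le {ι : Type*} [DecidableEq ι] {s : Finset ι} {c p : ι → ℝ} {η t : ℝ}
    (hc0 : ∀ j ∈ s, 0 ≤ c j) (hc : ∀ j ∈ s, c j ≤ η)
    (hp0 : ∀ l ∈ s, 0 ≤ p l) (hp : ∀ l ∈ s, p l ≤ t) :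
    ∑ j ∈ s, c j * ∏ l ∈ s.erase j, p l ≤ #s * (η * t ^ (#s - 1)) := by
  rw [← nsmul_eq_mul]
  refine sum_le_card_nsmul _ _ _ fun j hj => ?_
  have hprod : ∏ l ∈ s.erase j, p l ≤ t ^ (#s - 1) := by
    rw [← card_erase_of_mem hj, ← prod_const]
    exact prod_le_prod (fun l hl => hp0 l (mem_of_mem_erase hl))
      fun l hl => hp l (mem_of_mem_erase hl)
  exact mul_le_mul (hc j hj) hprod (prod_nonneg fun l hl => hp0 l (mem_of_mem_erase hl))
    ((hc0 j hj).trans (hc j hj))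

/-- If `f_1, …, f_k` are probability densities on `[0,1]` with
`α ≤ f_i ≤ η`, with CDFs `F_i`, then the "density"
`g_i(x) = (1 − F_i(x)) ∑_{j ≠ i} f_j(x) ∏_{l ≠ i,j} F_l(x)` satisfies `g_i(x) ≤ η²/α` on
`[0,1]`. -/
theorem second_price_density_upper_bound
    (k : ℕ) (hk : 2 ≤ k) (α η : ℝ) (hα : 0 < α) (hαη : α ≤ η)
    (f F : Fin k → ℝ → ℝ)
    (hf_meas : ∀ i, Measurable (f i))
    (hf_bounds : ∀ i, ∀ x ∈ Set.Icc (0:ℝ) 1, α ≤ f i x ∧ f i x ≤ η)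
    (hf_supp : ∀ i x, x ∉ Set.Icc (0:ℝ) 1 → f i x = 0)
    (hf_prob : ∀ i, (∫ x, f i x) = 1)
    (hF : ∀ i x, F i x = ∫ z in Set.Iic x, f i z) :
    ∀ i : Fin k, ∀ x ∈ Set.Icc (0:ℝ) 1,
      (1 - F i x) * ∑ j ∈ Finset.univ.erase i,
          f j x * ∏ l ∈ (Finset.univ.erase i).erase j, F l x
        ≤ η ^ 2 / α := by
  intro i x hx
  have hη : 0 < η := hα.trans_le hαη
  have hint (j) : Integrable (f j) := by
    by_contra h
    simpa [integral_undef h] using hf_prob j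
  have hf0 (j z) : 0 ≤ f j z := by
    by_cases hz : z ∈ Set.Icc (0 : ℝ) 1
    · exact hα.le.trans (hf_bounds j z hz).1
    · exact (hf_supp j z hz).ge
  have htail (j) : 1 - F j x ∈ Set.Icc (α * (1 - x)) (η * (1 - x)) := by
    rw [hF]
    exact one_sub_cdf_mem_Icc (hint j) (hf_bounds j) (hf_supp j) (hf_prob j) hx
  have hF0 (j) : 0 ≤ F j x := by
    rw [hF]
    exact integral_nonneg (hf0 j)
  have hF1 (j) : F j x ≤ 1 :=
    sub_nonneg.1 ((mul_nonneg hα.le (sub_nonneg.2 hx.2)).trans (htail j).1)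
  have hcard : #(univ.erase i) = k - 1 := by simp
  obtain ⟨m, -, hm⟩ := exists_max_image (univ.erase i) (fun l => F l x)
    (card_pos.1 (by omega))
  have hcompare : 1 - F i x ≤ η / α * (1 - F m x) :=
    calc 1 - F i x ≤ η * (1 - x) := (htail i).2
      _ = η / α * (α * (1 - x)) := by field_simp
      _ ≤ η / α * (1 - F m x) :=
        mul_le_mul_of_nonneg_left (htail m).1 (div_pos hη hα).le
  have hsum := sum_mul_prod_erase_le (s := univ.erase i) (c := fun j => f j x)
    (p := fun l => F l x) (fun j _ => hf0 j x) (fun j _ => (hf_bounds j x hx).2)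
    (fun l _ => hF0 l) hm
  calc _ ≤ η / α * (1 - F m x) *
        (#(univ.erase i) * (η * F m x ^ (#(univ.erase i) - 1))) :=
      mul_le_mul hcompare hsum
        (sum_nonneg fun j _ => mul_nonneg (hf0 j x) (prod_nonneg fun l _ => hF0 l))
        (mul_nonneg (div_pos hη hα).le (sub_nonneg.2 (hF1 m)))
    _ = η ^ 2 / α *
        (#(univ.erase i) * (1 - F m x) * F m x ^ (#(univ.erase i) - 1)) := by ring
    _ ≤ η ^ 2 / α :=
      mul_le_of_le_one_right (by positivity)
        (nat_mul_one_sub_mul_pow_le_one (hF0 m) (hF1 m) _)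
end

section
/- Let k ≥ 2 and let f_1, …, f_k be probability densities on [0,1] with α ≤ f_i(x) ≤ η for all x and all i, where 0 < α ≤ η, and let F_i be the corresponding CDFs. Define U*_i(x) = ∏_{j ≠ i} F_j(x). Then for all i, j ∈ {1,…,k} and all 0 ≤ y < x ≤ 1: (α/η)³ · (U*_j(x) − U*_j(y)) ≤ U*_i(x) − U*_i(y) ≤ (η/α)³ · (U*_j(x) − U*_j(y)). -/
open MeasureTheory Finset

/-- The increments of the cumulative integral of a density bounded between `α` and `η` on `[0,1]`
are comparable to the length of the interval. -/
lemma setIntegral_Iic_sub_mem_Icc {α η : ℝ} {g : ℝ → ℝ} (hg : Integrable g)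
    (hb : ∀ x ∈ Set.Icc (0:ℝ) 1, α ≤ g x ∧ g x ≤ η) {y x : ℝ} (hy : 0 ≤ y) (hyx : y ≤ x)
    (hx : x ≤ 1) :
    (∫ z in Set.Iic x, g z) - (∫ z in Set.Iic y, g z) ∈
      Set.Icc (α * (x - y)) (η * (x - y)) := by
  rw [intervalIntegral.integral_Iic_sub_Iic hg.integrableOn hg.integrableOn]
  have hmem : ∀ z ∈ Set.Icc y x, z ∈ Set.Icc (0:ℝ) 1 :=
    fun z hz => ⟨hy.trans hz.1, hz.2.trans hx⟩
  have hconst : ∀ c : ℝ, (∫ _ in y..x, c) = c * (x - y) := fun c => by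
    simp [mul_comm]
  constructor
  · rw [← hconst α]
    exact intervalIntegral.integral_mono_on hyx intervalIntegrable_const
      hg.intervalIntegrable fun z hz => (hb z (hmem z hz)).1
  · rw [← hconst η]
    exact intervalIntegral.integral_mono_on hyx hg.intervalIntegrable
      intervalIntegrable_const fun z hz => (hb z (hmem z hz)).2

/-- A function vanishing on the negative half-line has zero integral over `(-∞, 0]`. -/
lemma setIntegral_Iic_zero_eq_zero {g : ℝ → ℝ} (hg : ∀ x < 0, g x = 0) :
    (∫ z in Set.Iic (0:ℝ), g z) = 0 := by
  rw [integral_Iic_eq_integral_Iio]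
  exact setIntegral_eq_zero_of_forall_eq_zero fun z hz => hg z hz

/-- If passing from `b` to `a` costs at most a factor `c`, both for the initial values and for the
increments, the same holds after multiplication by an increasing nonnegative factor `p`. -/
lemma mul_sub_mul_le_of_increment_le {p p' a a' b b' c : ℝ} (hp' : 0 ≤ p') (hp : p ≤ p')
    (hab : a ≤ c * b) (hinc : a' - a ≤ c * (b' - b)) :
    a' * p' - a * p ≤ c * (b' * p' - b * p) := by
  linarith [mul_le_mul_of_nonneg_right hinc hp',
    mul_le_mul_of_nonneg_right hab (sub_nonneg.2 hp)]

/-- Leave-one-out products of functions with comparable initial values and increments have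
comparable increments. -/
lemma prod_erase_sub_le {ι : Type*} [Fintype ι] [DecidableEq ι] {c : ℝ} (hc : 1 ≤ c)
    {u v : ι → ℝ} (hu : ∀ l, 0 ≤ u l) (huv : ∀ l, u l ≤ v l)
    (h : ∀ i j, u i ≤ c * u j) (hinc : ∀ i j, v i - u i ≤ c * (v j - u j)) (i j : ι) :
    ∏ l ∈ univ.erase i, v l - ∏ l ∈ univ.erase i, u l ≤
      c * (∏ l ∈ univ.erase j, v l - ∏ l ∈ univ.erase j, u l) := by
  have hmono : ∀ s : Finset ι, ∏ l ∈ s, u l ≤ ∏ l ∈ s, v l := fun s =>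
    prod_le_prod (fun l _ => hu l) fun l _ => huv l
  rcases eq_or_ne i j with rfl | hij
  · exact le_mul_of_one_le_left (sub_nonneg.2 (hmono _)) hc
  · have hi : ∀ w : ι → ℝ,
        ∏ l ∈ univ.erase i, w l = w j * ∏ l ∈ (univ.erase i).erase j, w l := fun w =>
      (mul_prod_erase _ w (by simp [hij.symm])).symm
    have hj : ∀ w : ι → ℝ,
        ∏ l ∈ univ.erase j, w l = w i * ∏ l ∈ (univ.erase i).erase j, w l := fun w => by
      rw [erase_right_comm]
      exact (mul_prod_erase _ w (by simp [hij])).symm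
    rw [hi, hi, hj, hj]
    exact mul_sub_mul_le_of_increment_le (prod_nonneg fun l _ => (hu l).trans (huv l))
      (hmono _) (h j i) (hinc j i)

/-- If `f_1, …, f_k` are probability densities on `[0,1]` with `α ≤ f_i ≤ η`
and CDFs `F_i`, and `U*_i(x) = ∏_{j ≠ i} F_j(x)`, then for all `i, j` and `0 ≤ y < x ≤ 1`:
`(α/η)³ (U*_j(x) − U*_j(y)) ≤ U*_i(x) − U*_i(y) ≤ (η/α)³ (U*_j(x) − U*_j(y))`. -/
theorem product_cdf_increment_comparison
    (k : ℕ) (hk : 2 ≤ k) (α η : ℝ) (hα : 0 < α) (hαη : α ≤ η)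
    (f F : Fin k → ℝ → ℝ)
    (hf_meas : ∀ i, Measurable (f i))
    (hf_bounds : ∀ i, ∀ x ∈ Set.Icc (0:ℝ) 1, α ≤ f i x ∧ f i x ≤ η)
    (hf_supp : ∀ i x, x ∉ Set.Icc (0:ℝ) 1 → f i x = 0)
    (hf_prob : ∀ i, (∫ x, f i x) = 1)
    (hF : ∀ i x, F i x = ∫ z in Set.Iic x, f i z) :
    ∀ i j : Fin k, ∀ y x : ℝ, 0 ≤ y → y < x → x ≤ 1 →
      (α / η) ^ 3 *
          (∏ l ∈ Finset.univ.erase j, F l x - ∏ l ∈ Finset.univ.erase j, F l y)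
        ≤ ∏ l ∈ Finset.univ.erase i, F l x - ∏ l ∈ Finset.univ.erase i, F l y ∧
      ∏ l ∈ Finset.univ.erase i, F l x - ∏ l ∈ Finset.univ.erase i, F l y
        ≤ (η / α) ^ 3 *
            (∏ l ∈ Finset.univ.erase j, F l x - ∏ l ∈ Finset.univ.erase j, F l y) := by
  intro i j y x hy hyx hx
  have hη : 0 < η := hα.trans_le hαη
  have hone : 1 ≤ η / α := (one_le_div hα).2 hαη
  have hint : ∀ l, Integrable (f l) := fun l => by
    by_contra hn
    simpa [integral_undef hn] using hf_prob l
  have hzero : ∀ l, F l 0 = 0 := fun l => by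
    rw [hF]
    exact setIntegral_Iic_zero_eq_zero fun z hz => hf_supp l z fun h => hz.not_ge h.1
  have hinc : ∀ l, F l x - F l y ∈ Set.Icc (α * (x - y)) (η * (x - y)) := fun l => by
    rw [hF, hF]
    exact setIntegral_Iic_sub_mem_Icc (hint l) (hf_bounds l) hy hyx.le hx
  have hstart : ∀ l, F l y ∈ Set.Icc (α * y) (η * y) := fun l => by
    have := setIntegral_Iic_sub_mem_Icc (hint l) (hf_bounds l) le_rfl hy (hyx.le.trans hx)
    rwa [← hF, ← hF, hzero, sub_zero, sub_zero] at this
  have hratio : ∀ {a b t : ℝ}, 0 ≤ b → a ≤ η * t → α * t ≤ b → a ≤ (η / α) ^ 3 * b := by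
    intro a b t hb ha hbt
    calc a ≤ η * t := ha
      _ = η / α * (α * t) := by field_simp
      _ ≤ η / α * b := by gcongr
      _ ≤ (η / α) ^ 3 * b := by
        gcongr
        exact le_self_pow₀ hone (by norm_num)
  have hFy : ∀ l, 0 ≤ F l y := fun l => (mul_nonneg hα.le hy).trans (hstart l).1
  have hFinc : ∀ l, 0 ≤ F l x - F l y := fun l =>
    (mul_nonneg hα.le (sub_nonneg.2 hyx.le)).trans (hinc l).1
  have key := prod_erase_sub_le (one_le_pow₀ hone : 1 ≤ (η / α) ^ 3) hFy
    (fun l => sub_nonneg.1 (hFinc l))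
    (fun a b => hratio (hFy b) (hstart a).2 (hstart b).1)
    (fun a b => hratio (hFinc b) (hinc a).2 (hinc b).1)
  refine ⟨?_, key i j⟩
  rw [← inv_div, inv_pow, inv_mul_le_iff₀ (by positivity)]
  exact key j i
end
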